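/- arXiv:1905.09239 — 3 statements merged into one kernel-verified Lean document; each statement's English description precedes it below -/
import Mathlib

section
/- Suppose q_1 > γ. Then for every decision policy π there exists a decision policy π' with π'(x_1) = 1, π'(x_i) = 0 for every i with q_i < γ, and u(π',γ) ≥ u(π,γ). In particular, if a utility-maximizing policy exists, then there exists a utility-maximizing policy π* with π*(x_1) = 1 and π*(x_i) = 0 for all i with q_i < γ. -/
open scoped Classical

/-- The best response of an individual with features `x i` to policy `π` under cost `c`:
the element of `argmax_k (π k - c i k)` with the highest outcome and, among maximizers
with equal outcome, the lowest index.  Since indices are sorted in decreasing order of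
outcome, this is the minimal index among the maximizers. -/
noncomputable def bestResponse {m : ℕ} [NeZero m] (c : Fin m → Fin m → ℝ)
    (π : Fin m → ℝ) (i : Fin m) : Fin m :=
  (Finset.univ.filter (fun k => ∀ l, π l - c i l ≤ π k - c i k)).min' (by
    obtain ⟨k, -, hk⟩ := Finset.exists_max_image Finset.univ (fun k => π k - c i k)
      ⟨i, Finset.mem_univ i⟩
    exact ⟨k, Finset.mem_filter.mpr ⟨Finset.mem_univ k, fun l => hk l (Finset.mem_univ l)⟩⟩)

/-- The utility of a decision policy `π`:  `u(π,γ) = Σ_i P(x_i) · π(x_{br_π(i)}) · (q_{br_π(i)} − γ)`. -/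
noncomputable def utility {m : ℕ} [NeZero m] (P q : Fin m → ℝ) (c : Fin m → Fin m → ℝ)
    (γ : ℝ) (π : Fin m → ℝ) : ℝ :=
  ∑ i, P i * π (bestResponse c π i) * (q (bestResponse c π i) - γ)

/-- A decision policy takes values in `[0,1]`. -/
def IsPolicy {m : ℕ} (π : Fin m → ℝ) : Prop := ∀ i, 0 ≤ π i ∧ π i ≤ 1


theorem le_bestResponse {m : ℕ} [NeZero m] (c : Fin m → Fin m → ℝ) (π : Fin m → ℝ)
    (i l : Fin m) :
    π l - c i l ≤ π (bestResponse c π i) - c i (bestResponse c π i) :=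
  (Finset.mem_filter.mp (Finset.min'_mem
    (Finset.univ.filter (fun k => ∀ l, π l - c i l ≤ π k - c i k)) _)).2 l

theorem bestResponse_le {m : ℕ} [NeZero m] (c : Fin m → Fin m → ℝ) (π : Fin m → ℝ)
    (i k : Fin m) (hk : ∀ l, π l - c i l ≤ π k - c i k) : bestResponse c π i ≤ k :=
  Finset.min'_le _ _ (Finset.mem_filter.mpr ⟨Finset.mem_univ k, hk⟩)

/-- The policy that accepts the top feature value, rejects all features with outcome below `γ`,
and agrees with `π` elsewhere. -/
noncomputable def improvedPolicy {m : ℕ} [NeZero m] (q : Fin m → ℝ) (γ : ℝ) (π : Fin m → ℝ) :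
    Fin m → ℝ :=
  fun i => if i = 0 then 1 else if q i < γ then 0 else π i

theorem improvedPolicy_zero {m : ℕ} [NeZero m] (q : Fin m → ℝ) (γ : ℝ) (π : Fin m → ℝ) :
    improvedPolicy q γ π 0 = 1 := by
  simp [improvedPolicy]

theorem improvedPolicy_of_lt {m : ℕ} [NeZero m] {q : Fin m → ℝ} {γ : ℝ} (π : Fin m → ℝ)
    (hq1 : γ < q 0) {i : Fin m} (hi : q i < γ) : improvedPolicy q γ π i = 0 := by
  have h0 : i ≠ 0 := by
    rintro rfl
    exact lt_asymm hi hq1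
  simp [improvedPolicy, h0, hi]

theorem improvedPolicy_of_le {m : ℕ} [NeZero m] {q : Fin m → ℝ} {γ : ℝ} (π : Fin m → ℝ)
    {i : Fin m} (h0 : i ≠ 0) (hi : γ ≤ q i) : improvedPolicy q γ π i = π i := by
  simp [improvedPolicy, h0, hi.not_gt]

theorem improvedPolicy_le {m : ℕ} [NeZero m] (q : Fin m → ℝ) (γ : ℝ) {π : Fin m → ℝ}
    (hπ : IsPolicy π) {i : Fin m} (h0 : i ≠ 0) : improvedPolicy q γ π i ≤ π i := by
  simp only [improvedPolicy, h0, if_false]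
  split_ifs
  · exact (hπ i).1
  · exact le_rfl

theorem isPolicy_improvedPolicy {m : ℕ} [NeZero m] (q : Fin m → ℝ) (γ : ℝ) {π : Fin m → ℝ}
    (hπ : IsPolicy π) : IsPolicy (improvedPolicy q γ π) := by
  intro i
  unfold improvedPolicy
  split_ifs
  · norm_num
  · norm_num
  · exact hπ i

/-- An individual who best-responds to `π` with an outcome of at least `γ` either keeps the same
best response under the improved policy or moves to the top feature value. -/
theorem bestResponse_improvedPolicy {m : ℕ} [NeZero m] {q : Fin m → ℝ} (c : Fin m → Fin m → ℝ)
    {γ : ℝ} {π : Fin m → ℝ} (hπ : IsPolicy π) (i : Fin m) (hb : γ ≤ q (bestResponse c π i)) :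
    bestResponse c (improvedPolicy q γ π) i = 0 ∨
      (bestResponse c π i ≠ 0 ∧
        bestResponse c (improvedPolicy q γ π) i = bestResponse c π i) := by
  by_cases h0' : bestResponse c (improvedPolicy q γ π) i = 0
  · exact Or.inl h0'
  have hmax := le_bestResponse c π i
  have hmax' := le_bestResponse c (improvedPolicy q γ π) i
  have hle := improvedPolicy_le q γ hπ h0'
  by_cases h0 : bestResponse c π i = 0
  · refine absurd (nonpos_iff_eq_zero.mp (bestResponse_le c _ i 0 fun l => ?_)) h0'
    have h1 := hmax (bestResponse c (improvedPolicy q γ π) i)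
    rw [h0] at h1
    have h2 := improvedPolicy_zero q γ π
    have h3 := (hπ 0).2
    linarith [hmax' l]
  · have heq := improvedPolicy_of_le π h0 hb
    refine Or.inr ⟨h0, le_antisymm ?_ ?_⟩
    · refine bestResponse_le c _ i _ fun l => ?_
      linarith [hmax' l, hmax (bestResponse c (improvedPolicy q γ π) i)]
    · refine bestResponse_le c _ i _ fun l => ?_
      linarith [hmax l, hmax' (bestResponse c π i)]

theorem utility_le_utility_improvedPolicy {m : ℕ} [NeZero m] {P q : Fin m → ℝ}
    (c : Fin m → Fin m → ℝ) {γ : ℝ} (hP : ∀ i, 0 ≤ P i)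
    (hsort : ∀ i j : Fin m, i < j → q j ≤ q i) (hq1 : γ < q 0)
    {π : Fin m → ℝ} (hπ : IsPolicy π) :
    utility P q c γ π ≤ utility P q c γ (improvedPolicy q γ π) := by
  refine Finset.sum_le_sum fun i _ => ?_
  rw [mul_assoc, mul_assoc]
  refine mul_le_mul_of_nonneg_left ?_ (hP i)
  obtain ⟨hb0, hb1⟩ := hπ (bestResponse c π i)
  rcases lt_or_ge (q (bestResponse c π i)) γ with hb | hb
  · refine (mul_nonpos_of_nonneg_of_nonpos hb0 (sub_nonpos.mpr hb.le)).trans ?_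
    rcases lt_or_ge (q (bestResponse c (improvedPolicy q γ π) i)) γ with hb' | hb'
    · simp [improvedPolicy_of_lt π hq1 hb']
    · exact mul_nonneg (isPolicy_improvedPolicy q γ hπ _).1 (sub_nonneg.mpr hb')
  · rcases bestResponse_improvedPolicy c hπ i hb with h | ⟨h0, h⟩
    · have hq0 : q (bestResponse c π i) ≤ q 0 := by
        rcases (Fin.zero_le (bestResponse c π i)).eq_or_lt with h0 | h0
        · rw [← h0]
        · exact hsort _ _ h0
      rw [h, improvedPolicy_zero]
      exact mul_le_mul hb1 (by linarith) (by linarith) zero_le_one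
    · rw [h, improvedPolicy_of_le π h0 hb]

/-- If `q 0 > γ`, every policy can be improved to one with `π' x₁ = 1` and `π' xᵢ = 0`
whenever `qᵢ < γ`; in particular, if a utility-maximizing policy exists then a
utility-maximizing policy with these properties exists. -/
theorem stmt0 {m : ℕ} [NeZero m]
    (P q : Fin m → ℝ) (c : Fin m → Fin m → ℝ) (γ : ℝ)
    (hP : ∀ i, 0 ≤ P i) (hPsum : ∑ i, P i = 1)
    (hq : ∀ i, 0 ≤ q i ∧ q i ≤ 1)
    (hsort : ∀ i j : Fin m, i < j → q j ≤ q i)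
    (hcdiag : ∀ i, c i i = 0) (hcnonneg : ∀ i j, 0 ≤ c i j)
    (hctri : ∀ i j k, c i k ≤ c i j + c j k)
    (hcpos : ∀ i j, i ≠ j → q i ≤ q j → 0 < c i j)
    (hγ0 : 0 < γ) (hγ1 : γ < 1)
    (hq1 : γ < q 0) :
    (∀ π : Fin m → ℝ, IsPolicy π →
      ∃ π' : Fin m → ℝ, IsPolicy π' ∧ π' 0 = 1 ∧ (∀ i, q i < γ → π' i = 0) ∧
        utility P q c γ π ≤ utility P q c γ π') ∧
    ((∃ πmax : Fin m → ℝ, IsPolicy πmax ∧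
        ∀ π : Fin m → ℝ, IsPolicy π → utility P q c γ π ≤ utility P q c γ πmax) →
      ∃ πstar : Fin m → ℝ, IsPolicy πstar ∧ πstar 0 = 1 ∧ (∀ i, q i < γ → πstar i = 0) ∧
        ∀ π : Fin m → ℝ, IsPolicy π → utility P q c γ π ≤ utility P q c γ πstar) := by
  have himprove : ∀ π : Fin m → ℝ, IsPolicy π →
      utility P q c γ π ≤ utility P q c γ (improvedPolicy q γ π) :=
    fun _ hπ => utility_le_utility_improvedPolicy c hP hsort hq1 hπ
  refine ⟨fun π hπ => ⟨improvedPolicy q γ π, isPolicy_improvedPolicy q γ hπ,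
    improvedPolicy_zero q γ π, fun _ hi => improvedPolicy_of_lt π hq1 hi, himprove π hπ⟩, ?_⟩
  rintro ⟨π, hπ, hmax⟩
  exact ⟨improvedPolicy q γ π, isPolicy_improvedPolicy q γ hπ, improvedPolicy_zero q γ π,
    fun _ hi => improvedPolicy_of_lt π hq1 hi, fun σ hσ => (hmax σ hσ).trans (himprove π hπ)⟩
end

section
/- Let c be additive and outcome monotonic, let π* be an outcome monotonic policy, and let i > 1 with q_i > γ be the index with the highest outcome (i.e. the smallest index) among indices at which π* violates the binary condition, and suppose π*(x_i) < π*(x_{i-1}) − c(x_i,x_{i-1}). Then the policy π' defined by π'(x_j) = π*(x_j) for all j ≠ i and π'(x_i) = π*(x_{i-1}) − c(x_i,x_{i-1}) satisfies br_{π'}(k) = br_{π*}(k) for every individual k and u(π',γ) ≥ u(π*,γ). -/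
open scoped Classical

/-- Raising the policy at `i` up to `π j - c i j`, where `j < i`, leaves best responses
unchanged, and nobody responds with `i`. -/
theorem bestResponse_raise {m : ℕ} [NeZero m] (c : Fin m → Fin m → ℝ)
    (hctri : ∀ i j k, c i k ≤ c i j + c j k) (π : Fin m → ℝ) (i j : Fin m) (hji : j < i)
    (hlt : π i < π j - c i j) (k : Fin m) :
    bestResponse c π k ≠ i ∧
      bestResponse c (fun l => if l = i then π j - c i j else π l) k = bestResponse c π k := by
  set π' : Fin m → ℝ := fun l => if l = i then π j - c i j else π l with hπ'
  have hi : π' i = π j - c i j := if_pos rfl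
  have hne : ∀ l, l ≠ i → π' l = π l := fun l hl => if_neg hl
  have htri := hctri k i j
  have hb : bestResponse c π k ≠ i := by
    intro h
    have hmax := le_bestResponse c π k j
    rw [h] at hmax
    linarith
  have hb' : bestResponse c π' k ≠ i := by
    intro h
    have hmax := le_bestResponse c π' k
    rw [h] at hmax
    have hle : bestResponse c π' k ≤ j := by
      refine bestResponse_le c π' k j fun l => (hmax l).trans ?_
      rw [hi, hne j hji.ne]
      linarith
    rw [h] at hle
    exact absurd hle (not_le.mpr hji)
  refine ⟨hb, le_antisymm (bestResponse_le c π' k _ fun l => ?_)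
    (bestResponse_le c π k _ fun l => ?_)⟩
  · rw [hne _ hb]
    by_cases hl : l = i
    · have hmax := le_bestResponse c π k j
      rw [hl, hi]
      linarith
    · rw [hne l hl]
      exact le_bestResponse c π k l
  · have hmax := le_bestResponse c π' k l
    rw [hne _ hb'] at hmax
    by_cases hl : l = i
    · rw [hl, hi] at hmax
      rw [hl]
      linarith
    · rwa [hne l hl] at hmax

/-- Second case in the proof of Theorem 2: if `i` is the smallest index (highest outcome)
at which the outcome monotonic policy `π*` violates the binary condition and
`π* i < π* ip − c i ip` (where `ip` is the predecessor of `i`), then raising `π* i` to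
`π* ip − c i ip` leaves all best responses unchanged and does not decrease utility. -/
theorem stmt9 {m : ℕ} [NeZero m]
    (P q : Fin m → ℝ) (c : Fin m → Fin m → ℝ) (γ : ℝ)
    (hP : ∀ i, 0 ≤ P i) (hPsum : ∑ i, P i = 1)
    (hq : ∀ i, 0 ≤ q i ∧ q i ≤ 1)
    (hsort : ∀ i j : Fin m, i < j → q j ≤ q i)
    (hcdiag : ∀ i, c i i = 0) (hcnonneg : ∀ i j, 0 ≤ c i j)
    (hctri : ∀ i j k, c i k ≤ c i j + c j k)
    (hcpos : ∀ i j, i ≠ j → q i ≤ q j → 0 < c i j)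
    (hγ0 : 0 < γ) (hγ1 : γ < 1)
    (hcm0 : ∀ i j, q j < q i → c i j = 0)
    (hcm1 : ∀ i j k, q i < q j → q j < q k → c i j < c i k)
    (hcm2 : ∀ i j k, q k < q j → q j < q i → c j i < c k i)
    (hcadd : ∀ i j k : Fin m, j ≤ k → k ≤ i → c i j = c i k + c k j)
    (πstar : Fin m → ℝ) (hπstar : IsPolicy πstar)
    (hmono : ∀ i j, q i < q j ↔ πstar i < πstar j)
    (i ip : Fin m) (hip : (ip : ℕ) + 1 = (i : ℕ)) (hqi : γ < q i)
    (hviol : πstar i < πstar ip - c i ip)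
    (hmin : ∀ k k' : Fin m, (k' : ℕ) + 1 = (k : ℕ) → γ < q k → k < i →
      (πstar k = πstar k' ∨ πstar k = πstar k' - c k k')) :
    (∀ k, bestResponse c (fun j => if j = i then πstar ip - c i ip else πstar j) k =
      bestResponse c πstar k) ∧
    utility P q c γ πstar ≤
      utility P q c γ (fun j => if j = i then πstar ip - c i ip else πstar j) := by
  have hlt : ip < i := Fin.lt_def.mpr (by omega)
  have h := bestResponse_raise c hctri πstar i ip hlt hviol
  refine ⟨fun k => (h k).2, le_of_eq ?_⟩
  unfold utility
  refine Finset.sum_congr rfl fun k _ => ?_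
  rw [(h k).2]
  simp only [if_neg (h k).1]
end

section
/- In the toy instance with cost matrix c = [[0,0,0],[0.3,0,0],[1.2,0.3,0]], every deterministic policy is strictly suboptimal: for every policy π : {1,2,3} → {0,1}, u(π, 0.1) < 0.66 = u(π*, 0.1), where π* is the stochastic policy with π*(x_1) = 1, π*(x_2) = 0.7, π*(x_3) = 0. -/
open scoped Classical

/-- The cost matrix of the toy instance: `c = [[0,0,0],[0.3,0,0],[1.2,0.3,0]]`. -/
noncomputable def toyCost : Fin 3 → Fin 3 → ℝ :=
  ![![0, 0, 0], ![0.3, 0, 0], ![1.2, 0.3, 0]]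

/-- The utility in the toy instance with `P = (0.1, 0.4, 0.5)`, `q = (1, 0.7, 0.4)`,
`γ = 0.1` and the cost matrix `toyCost`. -/
noncomputable def toyUtility (π : Fin 3 → ℝ) : ℝ :=
  utility ![0.1, 0.4, 0.5] ![1, 0.7, 0.4] toyCost 0.1 π

theorem bestResponse_eq {m : ℕ} [NeZero m] {c : Fin m → Fin m → ℝ} {π : Fin m → ℝ}
    {i k : Fin m} (hmax : ∀ l, π l - c i l ≤ π k - c i k)
    (hlt : ∀ l < k, π l - c i l < π k - c i k) : bestResponse c π i = k := by
  refine le_antisymm (Finset.min'_le _ _ (by simpa using hmax)) (Finset.le_min' _ _ _ ?_)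
  intro l hl
  by_contra! hlk
  exact ((Finset.mem_filter.mp hl).2 k).not_gt (hlt l hlk)

theorem toyUtility_eq_of_argmax {π : Fin 3 → ℝ} (r : Fin 3 → Fin 3)
    (hmax : ∀ i l, π l - toyCost i l ≤ π (r i) - toyCost i (r i))
    (hlt : ∀ i, ∀ l < r i, π l - toyCost i l < π (r i) - toyCost i (r i)) :
    toyUtility π = ∑ i, (![0.1, 0.4, 0.5] : Fin 3 → ℝ) i * π (r i) *
      ((![1, 0.7, 0.4] : Fin 3 → ℝ) (r i) - 0.1) := by
  simp only [toyUtility, utility, fun i => bestResponse_eq (hmax i) (hlt i)]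

/-- In the toy instance, every deterministic policy is strictly suboptimal: any
`{0,1}`-valued policy achieves utility strictly less than `0.66`, the utility of the
stochastic policy `π* = (1, 0.7, 0)`. -/
theorem stmt12 :
    toyUtility ![1, 0.7, 0] = 0.66 ∧
    ∀ π : Fin 3 → ℝ, (∀ i, π i = 0 ∨ π i = 1) → toyUtility π < 0.66 := by
  constructor
  · rw [toyUtility_eq_of_argmax ![0, 0, 1]] <;> simp [toyCost, Fin.forall_fin_succ, Fin.sum_univ_three] <;>
      norm_num
  · intro π hπ
    obtain ⟨x, y, z, rfl⟩ : ∃ x y z, π = ![x, y, z] :=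
      ⟨π 0, π 1, π 2, by ext i; fin_cases i <;> rfl⟩
    have hx : x = 0 ∨ x = 1 := hπ 0
    have hy : y = 0 ∨ y = 1 := hπ 1
    have hz : z = 0 ∨ z = 1 := hπ 2
    rcases hx with rfl | rfl <;> rcases hy with rfl | rfl <;> rcases hz with rfl | rfl
    · rw [toyUtility_eq_of_argmax ![0, 1, 2]] <;> simp [toyCost, Fin.forall_fin_succ, Fin.sum_univ_three] <;>
      norm_num
    · rw [toyUtility_eq_of_argmax ![2, 2, 2]] <;> simp [toyCost, Fin.forall_fin_succ, Fin.sum_univ_three] <;>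
      norm_num
    · rw [toyUtility_eq_of_argmax ![1, 1, 1]] <;> simp [toyCost, Fin.forall_fin_succ, Fin.sum_univ_three] <;>
      norm_num
    · rw [toyUtility_eq_of_argmax ![1, 1, 2]] <;> simp [toyCost, Fin.forall_fin_succ, Fin.sum_univ_three] <;>
      norm_num
    · rw [toyUtility_eq_of_argmax ![0, 0, 2]] <;> simp [toyCost, Fin.forall_fin_succ, Fin.sum_univ_three] <;>
      norm_num
    · rw [toyUtility_eq_of_argmax ![0, 2, 2]] <;> simp [toyCost, Fin.forall_fin_succ, Fin.sum_univ_three] <;>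
      norm_num
    · rw [toyUtility_eq_of_argmax ![0, 1, 1]] <;> simp [toyCost, Fin.forall_fin_succ, Fin.sum_univ_three] <;>
      norm_num
    · rw [toyUtility_eq_of_argmax ![0, 1, 2]] <;> simp [toyCost, Fin.forall_fin_succ, Fin.sum_univ_three] <;>
      norm_num
end
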